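/- arXiv:1102.4251 — 3 statements merged into one kernel-verified Lean document; each statement's English description precedes it below -/
import Mathlib

section
/- Let n ≥ 3 and 1 ≤ k ≤ n−2, and let Λ = ℤv₁ + ⋯ + ℤv_k be the rank-k lattice spanned by ℝ-linearly independent vectors v₁, …, v_k ∈ ℝⁿ. Then for every x ∈ ℝⁿ∖Λ the family (|x+ω|^{2−n} − |ω|^{2−n})_{ω ∈ Λ∖{0}} of real numbers is summable; in particular the modified series |x|^{2−n} + Σ_{ω∈Λ∖{0}} (|x+ω|^{2−n} − |ω|^{2−n}) converges absolutely for every x ∈ ℝⁿ∖Λ. -/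
noncomputable section

abbrev Euc (n : ℕ) := EuclideanSpace ℝ (Fin n)

/-- The lattice point `m₁v₁ + ⋯ + m_kv_k` associated to integer coefficients `m`. -/
def latt {n k : ℕ} (v : Fin k → Euc n) (m : Fin k → ℤ) : Euc n :=
  ∑ i, (m i : ℝ) • v i

/-- The lattice `Λ = ℤv₁ + ⋯ + ℤv_k` spanned by the vectors `v i`. -/
def lattice {n k : ℕ} (v : Fin k → Euc n) : Set (Euc n) := Set.range (latt v)

/-- The `ℤ`-span of a linearly independent family in a finite-dimensional real normed space is
discrete. -/
theorem LinearIndependent.discreteTopology_span_int {ι E : Type*} [NormedAddCommGroup E]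
    [NormedSpace ℝ E] [FiniteDimensional ℝ E] {v : ι → E} (hv : LinearIndependent ℝ v) :
    DiscreteTopology (Submodule.span ℤ (Set.range v)) := by
  have hd : DiscreteTopology
      (Submodule.span ℤ (Set.range (Module.Basis.extend hv.linearIndepOn_id))) := by
    have : Finite (hv.linearIndepOn_id.extend (Set.subset_univ (Set.range v))) :=
      Module.Finite.finite_basis (Module.Basis.extend hv.linearIndepOn_id)
    infer_instance
  refine DiscreteTopology.of_subset hd (Submodule.span_mono ?_)
  rw [Module.Basis.range_extend]
  exact Module.Basis.subset_extend hv.linearIndepOn_id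

/-- A lattice has only finitely many points in any closed ball around the origin. -/
theorem Submodule.eventually_cofinite_lt_norm {E : Type*} [NormedAddCommGroup E]
    [ProperSpace E] (L : Submodule ℤ E) [DiscreteTopology L] (R : ℝ) :
    ∀ᶠ z : L in Filter.cofinite, R < ‖(z : E)‖ := by
  have H : IsClosed (X := E) L := @AddSubgroup.isClosed_of_discrete _ _ _ _ _
    L.toAddSubgroup (inferInstanceAs (DiscreteTopology L))
  refine ((Metric.finite_isBounded_inter_isClosed DiscreteTopology.isDiscrete
    (Metric.isBounded_closedBall (x := (0 : E)) (r := R)) H).preimage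
      Subtype.val_injective.injOn).subset fun z hz ↦ ?_
  simpa using hz

/-- The mean value estimate for `‖·‖⁻¹ ^ p` away from the origin. -/
theorem abs_inv_norm_add_pow_sub_le {E : Type*} [NormedAddCommGroup E] (p : ℕ) {x y : E}
    (h : 2 * ‖x‖ < ‖y‖) :
    |‖x + y‖⁻¹ ^ p - ‖y‖⁻¹ ^ p| ≤ 2 * ‖x‖ * p * 2 ^ (p - 1) * ‖y‖⁻¹ ^ (p + 1) := by
  rcases p with _ | q
  · simp
  have hy : 0 < ‖y‖ := by linarith [norm_nonneg x]
  have hlow : ‖y‖ / 2 ≤ ‖x + y‖ := by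
    have := norm_sub_le (x + y) x
    rw [add_sub_cancel_left] at this
    linarith
  have hxy : 0 < ‖x + y‖ := by linarith
  have hinv : ‖x + y‖⁻¹ ≤ 2 * ‖y‖⁻¹ := by
    rw [← div_eq_mul_inv, ← inv_div]
    exact inv_anti₀ (by positivity) hlow
  have hdiff : |‖x + y‖⁻¹ - ‖y‖⁻¹| ≤ 2 * ‖x‖ * ‖y‖⁻¹ ^ 2 := by
    rw [inv_sub_inv hxy.ne' hy.ne', abs_div, abs_of_pos (mul_pos hxy hy), div_eq_mul_inv,
      mul_inv]
    have h1 : |‖y‖ - ‖x + y‖| ≤ ‖x‖ := by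
      simpa [norm_neg] using abs_norm_sub_norm_le y (x + y)
    calc |‖y‖ - ‖x + y‖| * (‖x + y‖⁻¹ * ‖y‖⁻¹) ≤ ‖x‖ * (2 * ‖y‖⁻¹ * ‖y‖⁻¹) := by gcongr
      _ = 2 * ‖x‖ * ‖y‖⁻¹ ^ 2 := by ring
  have hmax : max |‖x + y‖⁻¹| |‖y‖⁻¹| ≤ 2 * ‖y‖⁻¹ := by
    have : 0 < ‖y‖⁻¹ := by positivity
    rw [abs_of_pos (inv_pos.2 hxy), abs_of_pos this]
    exact max_le hinv (by linarith)
  calc |‖x + y‖⁻¹ ^ (q + 1) - ‖y‖⁻¹ ^ (q + 1)|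
      ≤ |‖x + y‖⁻¹ - ‖y‖⁻¹| * (q + 1 : ℕ) * max |‖x + y‖⁻¹| |‖y‖⁻¹| ^ (q + 1 - 1) :=
        abs_pow_sub_pow_le ..
    _ ≤ 2 * ‖x‖ * ‖y‖⁻¹ ^ 2 * (q + 1 : ℕ) * (2 * ‖y‖⁻¹) ^ (q + 1 - 1) := by gcongr
    _ = _ := by
      rw [Nat.add_sub_cancel]
      ring

/-- Subtracting the constant term improves the exponent of convergence of `∑ ‖x + z‖⁻¹ ^ p` over a
lattice by one. -/
theorem ZLattice.summable_inv_norm_add_pow_sub {E : Type*} [NormedAddCommGroup E]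
    [NormedSpace ℝ E] [FiniteDimensional ℝ E] (L : Submodule ℤ E) [DiscreteTopology L]
    (p : ℕ) (hp : Module.finrank ℤ L ≤ p) (x : E) :
    Summable fun z : L ↦ ‖x + (z : E)‖⁻¹ ^ p - ‖(z : E)‖⁻¹ ^ p := by
  have : ProperSpace E := FiniteDimensional.proper ℝ E
  refine Summable.of_norm_bounded_eventually
    ((ZLattice.summable_norm_pow_inv L (p + 1) (Nat.lt_succ_of_le hp)).mul_left
      (2 * ‖x‖ * p * 2 ^ (p - 1))) ?_
  filter_upwards [L.eventually_cofinite_lt_norm (2 * ‖x‖)] with z hz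
  exact abs_inv_norm_add_pow_sub_le p hz

theorem lattice_eq_span {n k : ℕ} (v : Fin k → Euc n) :
    lattice v = Submodule.span ℤ (Set.range v) := by
  ext y
  simp [lattice, latt, Submodule.mem_span_range_iff_exists_fun, Int.cast_smul_eq_zsmul]

/-- For `n ≥ 3`, `1 ≤ k ≤ n-2` and a rank-`k` lattice `Λ`: for every
`x ∈ ℝⁿ∖Λ` the family `(|x+ω|^{2-n} - |ω|^{2-n})_{ω∈Λ∖{0}}` is summable; in particular the
modified series `|x|^{2-n} + Σ_{ω∈Λ∖{0}} (|x+ω|^{2-n} - |ω|^{2-n})` converges absolutely. -/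
theorem stmt5 (n k : ℕ) (hn : 3 ≤ n) (hk1 : 1 ≤ k) (hk2 : k ≤ n - 2)
    (v : Fin k → Euc n) (hv : LinearIndependent ℝ v) :
    ∀ x : Euc n, x ∉ lattice v →
      Summable (fun ω : ↥(lattice v \ {0}) =>
        ‖x + (ω : Euc n)‖ ^ (2 - (n : ℝ)) - ‖(ω : Euc n)‖ ^ (2 - (n : ℝ))) ∧
      Summable (fun ω : ↥(lattice v \ {0}) =>
        |‖x + (ω : Euc n)‖ ^ (2 - (n : ℝ)) - ‖(ω : Euc n)‖ ^ (2 - (n : ℝ))|) := by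
  intro x _
  rw [summable_abs_iff, and_self]
  have := hv.discreteTopology_span_int
  have hrank : Module.finrank ℤ (Submodule.span ℤ (Set.range v)) ≤ n - 2 := by
    rwa [finrank_span_eq_card (hv.restrict_scalars' ℤ), Fintype.card_fin]
  have hsum := ZLattice.summable_inv_norm_add_pow_sub _ (n - 2) hrank x
  have hsub : lattice v \ {0} ⊆ Submodule.span ℤ (Set.range v) :=
    Set.sdiff_subset.trans (lattice_eq_span v).subset
  have hexp (t : ℝ) (ht : 0 ≤ t) : t ^ (2 - (n : ℝ)) = t⁻¹ ^ (n - 2) := by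
    rw [show 2 - (n : ℝ) = -((n - 2 : ℕ) : ℝ) by
      rw [Nat.cast_sub (by lia)]; push_cast; ring, Real.rpow_neg ht, Real.rpow_natCast, inv_pow]
  simp_rw [hexp _ (norm_nonneg _)]
  have hcomp := hsum.comp_injective (i := Set.inclusion hsub) (Set.inclusion_injective hsub)
  exact hcomp.congr fun ω ↦ rfl
end
end

section
/- Let n ≥ 3 and 1 ≤ k ≤ n−2, and let Λ = ℤv₁ + ⋯ + ℤv_k be the rank-k lattice spanned by ℝ-linearly independent vectors v₁, …, v_k ∈ ℝⁿ whose coordinates k+1, …, n all vanish. For ω = m₁v₁+⋯+m_kv_k ∈ Λ set sgn(ω) = (−1)^{m₁+⋯+m_k} and define γ_ω : ℝⁿ → ℝⁿ by γ_ω(x) = (x₁+ω₁, …, x_k+ω_k, x_{k+1}, …, x_{n−1}, sgn(ω)·x_n). Then for all x, y ∈ ℝⁿ with γ_ω(x) ≠ y for every ω ∈ Λ: (i) the family (|γ_ω(x) − y|^{2−n} − |ω|^{2−n})_{ω∈Λ∖{0}} of real numbers is summable, so H⁻(x,y) = |x−y|^{2−n} + Σ_{ω∈Λ∖{0}} (|γ_ω(x)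 − y|^{2−n} − |ω|^{2−n}) is well defined; and (ii) H⁻(γ_η(x), y) = H⁻(x, y) for every η ∈ Λ. -/
noncomputable section

/-- Comparison of negative powers of two nearby positive reals. -/
lemma abs_rpow_neg_sub_rpow_neg_le {p q A : ℝ} (N : ℕ) (hN : 1 ≤ N) (hq : 0 < q)
    (hpq : |p - q| ≤ A) (hA : 2 * A ≤ q) :
    |p ^ (-(N : ℝ)) - q ^ (-(N : ℝ))| ≤
      (A * N * 2 ^ (N - 1) * 2 ^ N) * q ^ (-((N : ℝ) + 1)) := by
  obtain ⟨h1, h2⟩ := abs_le.mp hpq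
  have hp2 : q / 2 ≤ p := by linarith
  have hp : 0 < p := by linarith
  have hA0 : 0 ≤ A := (abs_nonneg _).trans hpq
  obtain ⟨M, rfl⟩ : ∃ M, N = M + 1 := ⟨N - 1, by omega⟩
  have e : -(((M + 1 : ℕ) : ℝ) + 1) = -((M + 2 : ℕ) : ℝ) := by push_cast; ring
  rw [e]
  simp only [Real.rpow_neg hp.le, Real.rpow_neg hq.le, Real.rpow_natCast, Nat.add_sub_cancel]
  rw [inv_sub_inv (by positivity) (by positivity), abs_div,
    abs_of_pos (show 0 < p ^ (M + 1) * q ^ (M + 1) by positivity)]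
  have hnum : |q ^ (M + 1) - p ^ (M + 1)| ≤ A * (M + 1 : ℕ) * (2 * q) ^ M := by
    refine (abs_pow_sub_pow_le _ _ _).trans ?_
    rw [Nat.add_sub_cancel]
    gcongr
    · rwa [abs_sub_comm]
    · rw [abs_of_pos hp, abs_of_pos hq]
      exact max_le (by linarith) (by linarith)
  have hden : (q / 2) ^ (M + 1) * q ^ (M + 1) ≤ p ^ (M + 1) * q ^ (M + 1) := by gcongr
  calc |q ^ (M + 1) - p ^ (M + 1)| / (p ^ (M + 1) * q ^ (M + 1))
      ≤ (A * (M + 1 : ℕ) * (2 * q) ^ M) / ((q / 2) ^ (M + 1) * q ^ (M + 1)) := by gcongr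
    _ = A * (M + 1 : ℕ) * 2 ^ M * 2 ^ (M + 1) * (q ^ (M + 2))⁻¹ := by
      rw [div_pow, mul_pow]
      field_simp
      ring

lemma norm_intCast_pi {k : ℕ} (m : Fin k → ℤ) : ‖fun i => (m i : ℝ)‖ = ‖m‖ := by
  simp only [Pi.norm_def, NNReal.coe_inj]
  refine Finset.sup_congr rfl fun i _ => ?_
  rw [← NNReal.coe_inj, coe_nnnorm, coe_nnnorm, Int.norm_cast_real]

lemma summable_norm_int_rpow (k : ℕ) (r : ℝ) (hr : r < -k) :
    Summable fun m : Fin k → ℤ => ‖m‖ ^ r := by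
  let L := Submodule.span ℤ (Set.range (Pi.basisFun ℝ (Fin k)))
  have hrank : Module.finrank ℤ L = k := by
    exact (ZLattice.rank ℝ L).trans (by simp)
  have hmem (m : Fin k → ℤ) : (fun i => (m i : ℝ)) ∈ L := by
    rw [Module.Basis.mem_span_iff_repr_mem ℤ (Pi.basisFun ℝ (Fin k))]
    intro i
    exact ⟨m i, by simp⟩
  have hinj : Function.Injective fun m : Fin k → ℤ => (⟨fun i => (m i : ℝ), hmem m⟩ : L) := by
    intro a b hab
    funext i
    exact Int.cast_injective (α := ℝ) (congrFun (congrArg Subtype.val hab) i)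
  refine ((ZLattice.summable_norm_rpow L r (by rwa [hrank])).comp_injective hinj).congr ?_
  intro m
  exact congrArg (· ^ r) (norm_intCast_pi m)

lemma latt_add {n k : ℕ} (v : Fin k → Euc n) (a b : Fin k → ℤ) :
    latt v (a + b) = latt v a + latt v b := by
  simp [latt, add_smul, Finset.sum_add_distrib]

lemma latt_neg {n k : ℕ} (v : Fin k → Euc n) (a : Fin k → ℤ) :
    latt v (-a) = -latt v a := by
  simp [latt]

lemma exists_mul_norm_le_norm_latt {n k : ℕ} (v : Fin k → Euc n)
    (hv : LinearIndependent ℝ v) :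
    ∃ c : ℝ, 0 < c ∧ ∀ m : Fin k → ℤ, c * ‖m‖ ≤ ‖latt v m‖ := by
  let T : (Fin k → ℝ) →ₗ[ℝ] Euc n := Fintype.linearCombination ℝ v
  have hT : LinearMap.ker T = ⊥ := by
    rw [LinearMap.ker_eq_bot]
    exact hv.fintypeLinearCombination_injective
  obtain ⟨K, hK, h⟩ := T.exists_antilipschitzWith hT
  refine ⟨(K : ℝ)⁻¹, by positivity, fun m => ?_⟩
  have := h.le_mul_dist (fun i => (m i : ℝ)) 0
  rw [map_zero, dist_zero_right, dist_zero_right, norm_intCast_pi] at this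
  have hK' : (0 : ℝ) < K := by exact_mod_cast hK
  rw [inv_mul_le_iff₀ hK']
  simpa [T, Fintype.linearCombination_apply, latt] using this

/-- Bounded perturbations of lattice vectors change the sum of `|ω|^{-N}` by a summable family as
soon as the rank is at most `N`. -/
lemma summable_norm_latt_add_rpow_sub {n k : ℕ} (v : Fin k → Euc n)
    (hv : LinearIndependent ℝ v) (N : ℕ) (hN : 1 ≤ N) (hk : k ≤ N)
    (d : (Fin k → ℤ) → Euc n) (A : ℝ) (hd : ∀ m, ‖d m‖ ≤ A) :
    Summable fun m : Fin k → ℤ =>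
      ‖latt v m + d m‖ ^ (-(N : ℝ)) - ‖latt v m‖ ^ (-(N : ℝ)) := by
  obtain ⟨c, hc, hcm⟩ := exists_mul_norm_le_norm_latt v hv
  have hA0 : 0 ≤ A := (norm_nonneg _).trans (hd 0)
  have hkN : (k : ℝ) ≤ N := by exact_mod_cast hk
  have hs := (summable_norm_int_rpow k (-((N : ℝ) + 1)) (by linarith)).mul_left
    ((A * N * 2 ^ (N - 1) * 2 ^ N) * c ^ (-((N : ℝ) + 1)))
  refine Summable.of_norm_bounded_eventually hs ?_
  have htend : Filter.Tendsto (fun m : Fin k → ℤ => ‖m‖) Filter.cofinite Filter.atTop := by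
    rw [← Filter.cocompact_eq_cofinite]
    exact tendsto_norm_cocompact_atTop
  filter_upwards [htend.eventually_ge_atTop (2 * A / c), htend.eventually_gt_atTop 0]
    with m hm hm0
  have hcpos : 0 < c * ‖m‖ := by positivity
  have hq : 0 < ‖latt v m‖ := hcpos.trans_le (hcm m)
  have h2A : 2 * A ≤ ‖latt v m‖ := by
    rw [div_le_iff₀' hc] at hm
    exact hm.trans (hcm m)
  have hpq : |‖latt v m + d m‖ - ‖latt v m‖| ≤ A := by
    refine (abs_norm_sub_norm_le _ _).trans ?_
    simpa using hd m
  rw [Real.norm_eq_abs]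
  refine (abs_rpow_neg_sub_rpow_neg_le N hN hq hpq h2A).trans ?_
  rw [mul_assoc _ (c ^ _), ← Real.mul_rpow hc.le (norm_nonneg m)]
  exact mul_le_mul_of_nonneg_left
    (Real.rpow_le_rpow_of_nonpos hcpos (hcm m) (by linarith)) (by positivity)

/-- Renormalised sums over a group are invariant under translation, when the subtracted family is
even. -/
lemma tsum_sub_translate_eq {G : Type*} [AddCommGroup G] (f g : G → ℝ) (η : G)
    (hg : ∀ m, g (-m) = g m) (h₀ : Summable fun m => f m - g m)
    (hη : Summable fun m => f (m + η) - g m) :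
    ∑' m, (f (m + η) - g m) = ∑' m, (f m - g m) := by
  have h₁ : Summable fun m => f m - g (m - η) := by
    refine ((Equiv.subRight η).summable_iff.mpr hη).congr fun m => ?_
    simp
  have e₁ : ∑' m, (f (m + η) - g m) = ∑' m, (f m - g (m - η)) := by
    rw [← (Equiv.subRight η).tsum_eq fun m => f (m + η) - g m]
    simp
  have e₂ : ∑' m, (g m - g (m - η)) = -∑' m, (g m - g (m - η)) := by
    rw [← tsum_neg, ← (Equiv.subLeft η).tsum_eq fun m => g m - g (m - η)]
    refine tsum_congr fun m => ?_
    have : g (η - m) = g (m - η) := by rw [← hg, neg_sub]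
    simp [this, hg]
  have e₃ := h₁.tsum_sub h₀
  have e₄ : ∑' m, (f m - g (m - η) - (f m - g m)) = ∑' m, (g m - g (m - η)) :=
    tsum_congr fun m => by ring
  rw [e₁]
  linarith

/-- Borderline case `k ≤ n-2` for the Möbius-type twisted translations
`γ_ω(x) = x + ω + ((sgn(ω)-1)·x_n) e_n`, `sgn(m₁v₁+⋯+m_kv_k) = (-1)^{m₁+⋯+m_k}`:
(i) the family `(|γ_ω(x)-y|^{2-n} - |ω|^{2-n})_{ω∈Λ∖{0}}` is summable whenever
`γ_ω(x) ≠ y` for all `ω`, so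
`H⁻(x,y) = |x-y|^{2-n} + Σ_{ω≠0} (|γ_ω(x)-y|^{2-n} - |ω|^{2-n})` is well defined;
(ii) `H⁻(γ_η(x),y) = H⁻(x,y)` for every `η ∈ Λ`. -/
theorem stmt13 (n k : ℕ) (hn : 3 ≤ n) (hk1 : 1 ≤ k) (hk2 : k ≤ n - 2)
    (v : Fin k → Euc n) (hv : LinearIndependent ℝ v)
    (hv0 : ∀ (i : Fin k) (j : Fin n), k ≤ (j : ℕ) → v i j = 0)
    (γ : (Fin k → ℤ) → Euc n → Euc n)
    (hγ : ∀ (m : Fin k → ℤ) (x : Euc n),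
      γ m x = x + latt v m +
        (((-1 : ℝ) ^ (∑ i, m i) - 1) * x ⟨n - 1, by omega⟩) •
          EuclideanSpace.single ⟨n - 1, by omega⟩ 1)
    (H : Euc n → Euc n → ℝ)
    (hH : ∀ x y : Euc n,
      H x y = ‖x - y‖ ^ (2 - (n : ℝ)) +
        ∑' m : {m : Fin k → ℤ // m ≠ 0},
          (‖γ (m : Fin k → ℤ) x - y‖ ^ (2 - (n : ℝ))
            - ‖latt v (m : Fin k → ℤ)‖ ^ (2 - (n : ℝ)))) :
    ∀ x y : Euc n, (∀ m : Fin k → ℤ, γ m x ≠ y) →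
      Summable (fun m : {m : Fin k → ℤ // m ≠ 0} =>
        ‖γ (m : Fin k → ℤ) x - y‖ ^ (2 - (n : ℝ))
          - ‖latt v (m : Fin k → ℤ)‖ ^ (2 - (n : ℝ))) ∧
      ∀ η : Fin k → ℤ, H (γ η x) y = H x y := by
  have hcast : (2 - (n : ℝ)) = -((n - 2 : ℕ) : ℝ) := by
    rw [Nat.cast_sub (by omega)]; push_cast; ring
  have hsum (x y : Euc n) : Summable fun m : Fin k → ℤ =>
      ‖γ m x - y‖ ^ (2 - (n : ℝ)) - ‖latt v m‖ ^ (2 - (n : ℝ)) := by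
    rw [hcast]
    refine (summable_norm_latt_add_rpow_sub v hv (n - 2) (by omega) hk2
      (fun m => x - y + (((-1 : ℝ) ^ (∑ i, m i) - 1) * x ⟨n - 1, by omega⟩) •
        EuclideanSpace.single ⟨n - 1, by omega⟩ 1)
      (‖x - y‖ + 2 * |x ⟨n - 1, by omega⟩|) fun m => ?_).congr fun m => ?_
    · refine (norm_add_le _ _).trans ?_
      have h2 : |(-1 : ℝ) ^ (∑ i, m i) - 1| ≤ 2 := by
        rcases Int.even_or_odd (∑ i, m i) with h | h
        · simp [h.neg_one_zpow]
        · rw [h.neg_one_zpow]; norm_num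
      rw [norm_smul, Real.norm_eq_abs, abs_mul, PiLp.norm_single, norm_one, mul_one]
      gcongr
    · congr 3
      rw [hγ]
      abel
  have hγ0 (x : Euc n) : γ 0 x = x := by
    rw [hγ]; simp [latt]
  have hne : (2 - (n : ℝ)) ≠ 0 := by
    have : (3 : ℝ) ≤ n := by exact_mod_cast hn
    linarith
  have hHt (x y : Euc n) : H x y = ∑' m : Fin k → ℤ,
      (‖γ m x - y‖ ^ (2 - (n : ℝ)) - ‖latt v m‖ ^ (2 - (n : ℝ))) := by
    rw [hH, ← (hsum x y).tsum_subtype_add_tsum_subtype_compl {0}]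
    congr 1
    rw [tsum_singleton (0 : Fin k → ℤ) (fun m : Fin k → ℤ =>
      ‖γ m x - y‖ ^ (2 - (n : ℝ)) - ‖latt v m‖ ^ (2 - (n : ℝ)))]
    simp [hγ0, latt, Real.zero_rpow hne]
  have hlast (m : Fin k → ℤ) : latt v m ⟨n - 1, by omega⟩ = 0 := by
    simp only [latt, WithLp.ofLp_sum, Finset.sum_apply, WithLp.ofLp_smul, Pi.smul_apply]
    refine Finset.sum_eq_zero fun i _ => ?_
    rw [hv0 i _ (show k ≤ n - 1 by omega), smul_zero]
  have hγadd (m η : Fin k → ℤ) (x : Euc n) : γ m (γ η x) = γ (m + η) x := by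
    have hc : γ η x ⟨n - 1, by omega⟩ = (-1 : ℝ) ^ (∑ i, η i) * x ⟨n - 1, by omega⟩ := by
      rw [hγ]
      simp [hlast]
      ring
    rw [hγ m (γ η x), hc, hγ η x, hγ (m + η) x, latt_add]
    simp only [Pi.add_apply, Finset.sum_add_distrib]
    rw [zpow_add₀ (by norm_num)]
    module
  intro x y _
  refine ⟨(hsum x y).subtype _, fun η => ?_⟩
  have hη := hsum (γ η x) y
  rw [hHt, hHt]
  simp only [hγadd] at hη ⊢
  exact tsum_sub_translate_eq (fun m => ‖γ m x - y‖ ^ (2 - (n : ℝ)))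
    (fun m => ‖latt v m‖ ^ (2 - (n : ℝ))) η (fun m => by simp only [latt_neg, norm_neg])
    (hsum x y) hη
end
end

section
/- Let n ≥ 5 and 2 ≤ k ≤ n−3. Let w₁, …, w_{k−1} be ℝ-linearly independent vectors in ℝⁿ whose coordinates k, k+1, …, n all vanish, and let Ω = ℤw₁ + ⋯ + ℤw_{k−1}. For μ ∈ Ω and m ∈ ℤ define γ_{(μ,m)} : ℝⁿ → ℝⁿ by γ_{(μ,m)}(x) = (x₁+μ₁, …, x_{k−1}+μ_{k−1}, (−1)^m x_k + m, x_{k+1}, …, x_n). Then: (i) the set {γ_{(μ,m)} : μ ∈ Ω, m ∈ ℤ} is a group of affine isometries of ℝⁿ under composition; (ii) for all x, y ∈ ℝⁿ with γ_{(μ,m)}(x) ≠ y for every (μ,m), the family (|γ_{(μ,m)}(x) − y|^{2−n})_{(μ,m) ∈ Ω × ℤ} is summable, so H*(x,y) = Σ_{(μ,m)} |γ_{(μ,m)}(x) − y|^{2−n} is well defined; (iii) H*(γ(x), y) = H*(x, y) for every γ in this group; (iv) for each fixed y, the function x ↦ H*(x,y) is harmonic on the open set {x ∈ ℝⁿ :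 γ(x) ≠ y for all γ in the group}. -/
noncomputable section

section NormRpow

set_option maxSynthPendingDepth 3

open Filter Topology Metric

variable {ι E : Type*} [NormedAddCommGroup E] {a : ι → E} {s : ℝ}

lemma tendsto_norm_cofinite_atTop (hs : s < 0)
    (ha : Summable fun p => (1 + ‖a p‖) ^ s) : Tendsto (fun p => ‖a p‖) cofinite atTop := by
  refine tendsto_atTop.2 fun R => ?_
  have h : (0 : ℝ) < (1 + |R|) ^ s := by positivity
  filter_upwards [ha.tendsto_cofinite_zero.eventually_lt_const h] with p hp
  rw [Real.rpow_lt_rpow_iff_of_neg (by positivity) (by positivity) hs] at hp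
  linarith [le_abs_self R]

lemma exists_mul_one_add_norm_le (hs : s < 0) (ha : Summable fun p => (1 + ‖a p‖) ^ s) {x : E}
    (hx : ∀ p, x ≠ a p) : ∃ c > 0, ∀ p, c * (1 + ‖a p‖) ≤ ‖x - a p‖ := by
  have hev : ∀ᶠ p in cofinite, (1 + ‖a p‖) / ‖x - a p‖ ≤ 2 := by
    filter_upwards [(tendsto_norm_cofinite_atTop hs ha).eventually_ge_atTop (2 * ‖x‖ + 2)] with p hp
    have : 0 < ‖x - a p‖ := norm_pos_iff.2 (sub_ne_zero.2 (hx p))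
    rw [div_le_iff₀ this]
    have := norm_sub_norm_le (a p) x
    rw [norm_sub_rev] at this
    linarith
  obtain ⟨M, hM⟩ := (show IsBoundedUnder (· ≤ ·) cofinite fun p => (1 + ‖a p‖) / ‖x - a p‖ from
    ⟨2, by simpa using hev⟩).bddAbove_range_of_cofinite
  refine ⟨(max M 1)⁻¹, by positivity, fun p => ?_⟩
  have h := hM (Set.mem_range_self p)
  rw [div_le_iff₀ (norm_pos_iff.2 (sub_ne_zero.2 (hx p)))] at h
  rw [inv_mul_le_iff₀ (by positivity)]
  exact h.trans (by gcongr; exact le_max_left _ _)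

lemma exists_mul_one_add_norm_le_ball (hs : s < 0) (ha : Summable fun p => (1 + ‖a p‖) ^ s) {x : E}
    (hx : ∀ p, x ≠ a p) :
    ∃ c > 0, ∃ r > 0, ∀ y ∈ ball x r, ∀ p, c * (1 + ‖a p‖) ≤ ‖y - a p‖ := by
  obtain ⟨c, hc, h⟩ := exists_mul_one_add_norm_le hs ha hx
  refine ⟨c / 2, by positivity, c / 2, by positivity, fun y hy p => ?_⟩
  rw [mem_ball_iff_norm'] at hy
  have := norm_sub_le_norm_sub_add_norm_sub x y (a p)
  nlinarith [h p, norm_nonneg (a p)]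

lemma norm_rpow_le_of_mul_le (hs : s ≤ 0) {c t : ℝ} (hc : 0 < c) (hts : t ≤ s) {y b : E}
    (h : c * (1 + ‖b‖) ≤ ‖y‖) : ‖y‖ ^ t ≤ c ^ t * (1 + ‖b‖) ^ s := by
  calc ‖y‖ ^ t ≤ (c * (1 + ‖b‖)) ^ t :=
        Real.rpow_le_rpow_of_nonpos (by positivity) h (hts.trans hs)
    _ = c ^ t * (1 + ‖b‖) ^ t := Real.mul_rpow hc.le (by positivity)
    _ ≤ c ^ t * (1 + ‖b‖) ^ s := by
        gcongr
        linarith [norm_nonneg b]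

lemma summable_norm_sub_rpow (hs : s < 0) (ha : Summable fun p => (1 + ‖a p‖) ^ s) {x : E}
    (hx : ∀ p, x ≠ a p) : Summable fun p => ‖x - a p‖ ^ s := by
  obtain ⟨c, hc, h⟩ := exists_mul_one_add_norm_le hs ha hx
  exact Summable.of_nonneg_of_le (fun p => by positivity)
    (fun p => norm_rpow_le_of_mul_le hs.le hc le_rfl (h p)) (ha.mul_left _)

lemma isOpen_setOf_forall_ne (hs : s < 0) (ha : Summable fun p => (1 + ‖a p‖) ^ s) :
    IsOpen {x : E | ∀ p, x ≠ a p} := by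
  refine Metric.isOpen_iff.2 fun x hx => ?_
  obtain ⟨c, hc, r, hr, h⟩ := exists_mul_one_add_norm_le_ball hs ha hx
  refine ⟨r, hr, fun y hy p hyp => ?_⟩
  have := h y hy p
  rw [hyp, sub_self, norm_zero] at this
  nlinarith [norm_nonneg (a p)]

variable [InnerProductSpace ℝ E]

/-- The real inner product as a continuous bilinear map. -/
def innerBilin (E : Type*) [NormedAddCommGroup E] [InnerProductSpace ℝ E] : E →L[ℝ] E →L[ℝ] ℝ :=
  innerSL ℝ

lemma innerBilin_apply (x y : E) : innerBilin E x y = inner ℝ x y := rfl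

lemma norm_innerBilin_apply (x : E) : ‖innerBilin E x‖ = ‖x‖ := innerSL_apply_norm ℝ x

lemma norm_innerBilin_le : ‖innerBilin E‖ ≤ 1 :=
  ContinuousLinearMap.opNorm_le_bound _ zero_le_one fun x => by
    rw [one_mul, norm_innerBilin_apply]

/-- The derivative of `z ↦ ‖z‖ ^ s` away from the origin. -/
def normRpowFDeriv (s : ℝ) (z : E) : E →L[ℝ] ℝ := (s * ‖z‖ ^ (s - 2)) • innerBilin E z

/-- The second derivative of `z ↦ ‖z‖ ^ s` away from the origin. -/
def normRpowHessian (s : ℝ) (z : E) : E →L[ℝ] E →L[ℝ] ℝ :=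
  (s * ‖z‖ ^ (s - 2)) • innerBilin E +
    ((s * ((s - 2) * ‖z‖ ^ (s - 2 - 2))) • innerBilin E z).smulRight (innerBilin E z)

lemma hasFDerivAt_norm_rpow_of_ne_zero (s : ℝ) {z : E} (hz : z ≠ 0) :
    HasFDerivAt (fun z : E => ‖z‖ ^ s) (normRpowFDeriv s z) z := by
  have h := ((hasStrictFDerivAt_norm_sq z).rpow_const (p := s / 2) (by simp [hz])).hasFDerivAt
  have e : ∀ (x : E) (t : ℝ), (‖x‖ ^ 2) ^ t = ‖x‖ ^ (2 * t) := fun x t => by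
    rw [← Real.rpow_natCast_mul (norm_nonneg x)]; norm_num
  refine (h.congr_fderiv ?_).congr_of_eventuallyEq (Eventually.of_forall fun x => ?_)
  · rw [e, normRpowFDeriv, ← Nat.cast_smul_eq_nsmul ℝ, smul_smul]
    congr 1
    rw [show 2 * (s / 2 - 1) = s - 2 by ring]
    push_cast
    ring
  · simp only [e]
    congr 1
    ring

lemma hasFDerivAt_normRpowFDeriv (s : ℝ) {z : E} (hz : z ≠ 0) :
    HasFDerivAt (normRpowFDeriv s : E → E →L[ℝ] ℝ) (normRpowHessian s z) z := by
  have h1 := ((hasFDerivAt_norm_rpow_of_ne_zero (s - 2) hz).const_mul s)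
  have h2 : HasFDerivAt (fun x : E => innerBilin E x) (innerBilin E) z := (innerBilin E).hasFDerivAt
  refine (h1.smul h2).congr_fderiv ?_
  simp only [normRpowHessian, normRpowFDeriv, smul_smul]

lemma continuousAt_normRpowHessian (s : ℝ) {z : E} (hz : z ≠ 0) :
    ContinuousAt (normRpowHessian s : E → E →L[ℝ] E →L[ℝ] ℝ) z := by
  have hc : ∀ t : ℝ, ContinuousAt (fun z : E => ‖z‖ ^ t) z := fun t =>
    (hasFDerivAt_norm_rpow_of_ne_zero t hz).continuousAt
  have hi : Continuous (fun x : E => innerBilin E x) := (innerBilin E).continuous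
  have h1 : ContinuousAt (fun z : E => (s * ‖z‖ ^ (s - 2)) • innerBilin E) z :=
    (continuousAt_const.mul (hc _)).smul continuousAt_const
  have h2 : ContinuousAt
      (fun z : E => (s * ((s - 2) * ‖z‖ ^ (s - 2 - 2))) • innerBilin E z) z :=
    (continuousAt_const.mul (continuousAt_const.mul (hc _))).smul hi.continuousAt
  exact h1.add (((ContinuousLinearMap.smulRightL ℝ E (E →L[ℝ] ℝ)).continuous₂.continuousAt).comp₂
    h2 hi.continuousAt)

lemma norm_normRpowFDeriv_le (s : ℝ) {z : E} (hz : z ≠ 0) :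
    ‖normRpowFDeriv s z‖ ≤ |s| * ‖z‖ ^ (s - 1) := by
  have hz' := norm_pos_iff.2 hz
  rw [normRpowFDeriv, norm_smul, norm_innerBilin_apply, norm_mul, Real.norm_eq_abs,
    Real.norm_of_nonneg (by positivity), mul_assoc, ← Real.rpow_add_one hz'.ne']
  ring_nf
  rfl

lemma norm_normRpowHessian_le (s : ℝ) {z : E} (hz : z ≠ 0) :
    ‖normRpowHessian s z‖ ≤ (|s| + |s * (s - 2)|) * ‖z‖ ^ (s - 2) := by
  have hz' := norm_pos_iff.2 hz
  rw [normRpowHessian, add_mul]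
  refine (norm_add_le _ _).trans (add_le_add ?_ ?_)
  · refine (norm_smul_le (s * ‖z‖ ^ (s - 2)) (innerBilin E)).trans ?_
    rw [norm_mul, Real.norm_eq_abs, Real.norm_of_nonneg (by positivity)]
    exact mul_le_of_le_one_right (by positivity) norm_innerBilin_le
  · rw [ContinuousLinearMap.norm_smulRight_apply, norm_smul, norm_innerBilin_apply, ← mul_assoc s,
      norm_mul, Real.norm_eq_abs, Real.norm_of_nonneg (by positivity), mul_assoc, mul_assoc]
    refine mul_le_mul_of_nonneg_left (le_of_eq ?_) (abs_nonneg _)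
    rw [← sq, ← Real.rpow_natCast, ← Real.rpow_add hz']
    norm_num

/-- The function `‖z‖ ^ (2 - n)` is harmonic away from the origin of `ℝⁿ`. -/
lemma sum_normRpowHessian_single {n : ℕ} {z : Euc n} (hz : z ≠ 0) :
    ∑ j : Fin n, normRpowHessian (2 - (n : ℝ)) z (EuclideanSpace.single j 1)
      (EuclideanSpace.single j 1) = 0 := by
  have hz' := norm_pos_iff.2 hz
  have hsq : ∑ j : Fin n, z j * z j = ‖z‖ ^ 2 := by
    simp only [EuclideanSpace.norm_sq_eq, Real.norm_eq_abs, sq_abs]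
    simp only [sq]
  have hp : ‖z‖ ^ (2 - (n : ℝ) - 2) = ‖z‖ ^ (2 - (n : ℝ) - 2 - 2) * ‖z‖ ^ 2 := by
    rw [← Real.rpow_natCast, ← Real.rpow_add hz']
    norm_num
  have : ∀ j : Fin n, normRpowHessian (2 - (n : ℝ)) z (EuclideanSpace.single j 1)
      (EuclideanSpace.single j 1) = (2 - (n : ℝ)) * ‖z‖ ^ (2 - (n : ℝ) - 2) +
      (2 - (n : ℝ)) * ((2 - (n : ℝ) - 2) * ‖z‖ ^ (2 - (n : ℝ) - 2 - 2)) * (z j * z j) := fun j => by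
    simp [normRpowHessian, innerBilin_apply, EuclideanSpace.inner_single_right]
    ring
  simp only [this, Finset.sum_add_distrib, ← Finset.mul_sum, hsq, hp]
  simp
  ring

lemma hasFDerivAt_comp_sub_const {F : Type*} [NormedAddCommGroup F] [NormedSpace ℝ F] {f : E → F}
    {f' : E →L[ℝ] F} {x b : E} (h : HasFDerivAt f f' (x - b)) :
    HasFDerivAt (fun y => f (y - b)) f' x := by
  rw [← f'.comp_id]
  exact h.comp x ((hasFDerivAt_id x).sub_const b)

/-- Termwise differentiation of `∑ ‖x - a p‖ ^ s` and of its derivative. -/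
lemma hasFDerivAt_tsum_norm_sub_rpow (hs : s < 0) (ha : Summable fun p => (1 + ‖a p‖) ^ s) {x : E}
    (hx : ∀ p, x ≠ a p) :
    HasFDerivAt (fun y => ∑' p, ‖y - a p‖ ^ s) (∑' p, normRpowFDeriv s (x - a p)) x ∧
    HasFDerivAt (fun y => ∑' p, normRpowFDeriv s (y - a p))
      (∑' p, normRpowHessian s (x - a p)) x ∧
    ContinuousAt (fun y => ∑' p, normRpowHessian s (y - a p)) x ∧
    Summable fun p => normRpowHessian s (x - a p) := by
  obtain ⟨c, hc, r, hr, h⟩ := exists_mul_one_add_norm_le_ball hs ha hx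
  have hne : ∀ p, ∀ y ∈ ball x r, y - a p ≠ 0 := fun p y hy => by
    rw [← norm_pos_iff]
    exact lt_of_lt_of_le (by positivity) (h y hy p)
  have hxr := mem_ball_self (x := x) hr
  have hb1 : ∀ p, ∀ y ∈ ball x r,
      ‖normRpowFDeriv s (y - a p)‖ ≤ |s| * (c ^ (s - 1) * (1 + ‖a p‖) ^ s) := fun p y hy =>
    (norm_normRpowFDeriv_le s (hne p y hy)).trans <| by
      gcongr
      exact norm_rpow_le_of_mul_le hs.le hc (by linarith) (h y hy p)
  have hb2 : ∀ p, ∀ y ∈ ball x r, ‖normRpowHessian s (y - a p)‖ ≤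
      (|s| + |s * (s - 2)|) * (c ^ (s - 2) * (1 + ‖a p‖) ^ s) := fun p y hy =>
    (norm_normRpowHessian_le s (hne p y hy)).trans <| by
      gcongr
      exact norm_rpow_le_of_mul_le hs.le hc (by linarith) (h y hy p)
  have hs1 := (ha.mul_left (c ^ (s - 1))).mul_left |s|
  have hs2 := (ha.mul_left (c ^ (s - 2))).mul_left (|s| + |s * (s - 2)|)
  have hpre := (convex_ball x r).isPreconnected
  refine ⟨?_, ?_, ?_, ?_⟩
  · exact hasFDerivAt_tsum_of_isPreconnected hs1 isOpen_ball hpre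
      (fun p y hy => hasFDerivAt_comp_sub_const (hasFDerivAt_norm_rpow_of_ne_zero s (hne p y hy)))
      hb1 hxr (summable_norm_sub_rpow hs ha hx) hxr
  · exact hasFDerivAt_tsum_of_isPreconnected hs2 isOpen_ball hpre
      (fun p y hy => hasFDerivAt_comp_sub_const (hasFDerivAt_normRpowFDeriv s (hne p y hy)))
      hb2 hxr (Summable.of_norm_bounded hs1 fun p => hb1 p x hxr) hxr
  · refine (continuousOn_tsum (F := E →L[ℝ] E →L[ℝ] ℝ) (fun p y hy => ?_) hs2 hb2).continuousAt
      (ball_mem_nhds x hr)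
    have := continuousAt_normRpowHessian s (hne p y hy)
    exact (ContinuousAt.comp (f := fun y => y - a p) this (by fun_prop)).continuousWithinAt
  · exact Summable.of_norm_bounded (E := E →L[ℝ] E →L[ℝ] ℝ) hs2 fun p => hb2 p x hxr

lemma contDiffOn_tsum_norm_sub_rpow (hs : s < 0) (ha : Summable fun p => (1 + ‖a p‖) ^ s) :
    ContDiffOn ℝ 2 (fun y => ∑' p, ‖y - a p‖ ^ s) {x | ∀ p, x ≠ a p} := by
  have ho := isOpen_setOf_forall_ne hs ha
  rw [show (2 : WithTop ℕ∞) = 1 + 1 by norm_num,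
    contDiffOn_succ_iff_hasFDerivWithinAt_of_uniqueDiffOn ho.uniqueDiffOn]
  refine ⟨by simp, _, ?_, fun x hx => (hasFDerivAt_tsum_norm_sub_rpow hs ha hx).1.hasFDerivWithinAt⟩
  rw [show (1 : WithTop ℕ∞) = 0 + 1 by norm_num,
    contDiffOn_succ_iff_hasFDerivWithinAt_of_uniqueDiffOn ho.uniqueDiffOn]
  refine ⟨by simp, _, contDiffOn_zero.2 fun x hx => ?_,
    fun x hx => (hasFDerivAt_tsum_norm_sub_rpow hs ha hx).2.1.hasFDerivWithinAt⟩
  exact (hasFDerivAt_tsum_norm_sub_rpow hs ha hx).2.2.1.continuousWithinAt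

lemma sum_fderiv_fderiv_tsum_norm_sub_rpow {n : ℕ} (hn : 2 < n) {a : ι → Euc n}
    (ha : Summable fun p => (1 + ‖a p‖) ^ (2 - (n : ℝ))) {x : Euc n} (hx : ∀ p, x ≠ a p) :
    ∑ j : Fin n, fderiv ℝ (fun z => fderiv ℝ (fun y => ∑' p, ‖y - a p‖ ^ (2 - (n : ℝ))) z
      (EuclideanSpace.single j 1)) x (EuclideanSpace.single j 1) = 0 := by
  have hs : 2 - (n : ℝ) < 0 := by
    have : (2 : ℝ) < n := by exact_mod_cast hn
    linarith
  obtain ⟨-, h2, -, hsum⟩ := hasFDerivAt_tsum_norm_sub_rpow hs ha hx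
  have h1 : ∀ᶠ z in 𝓝 x, fderiv ℝ (fun y => ∑' p, ‖y - a p‖ ^ (2 - (n : ℝ))) z =
      ∑' p, normRpowFDeriv (2 - (n : ℝ)) (z - a p) := by
    filter_upwards [(isOpen_setOf_forall_ne hs ha).mem_nhds hx] with z hz
    exact (hasFDerivAt_tsum_norm_sub_rpow hs ha hz).1.fderiv
  have key : ∀ j : Fin n, HasSum (fun p => normRpowHessian (2 - (n : ℝ)) (x - a p)
      (EuclideanSpace.single j 1) (EuclideanSpace.single j 1))
      (fderiv ℝ (fun z => fderiv ℝ (fun y => ∑' p, ‖y - a p‖ ^ (2 - (n : ℝ))) z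
      (EuclideanSpace.single j 1)) x (EuclideanSpace.single j 1)) := fun j => by
    set e : Euc n := EuclideanSpace.single j 1
    have h3 : (fun z => fderiv ℝ (fun y => ∑' p, ‖y - a p‖ ^ (2 - (n : ℝ))) z e) =ᶠ[𝓝 x]
        fun z => (∑' p, normRpowFDeriv (2 - (n : ℝ)) (z - a p)) e := by
      filter_upwards [h1] with z hz
      rw [hz]
    have h4 := (h2.clm_apply (hasFDerivAt_const e x)).fderiv
    rw [h3.fderiv_eq, h4]
    have := (hsum.hasSum.mapL (ContinuousLinearMap.apply ℝ (Euc n →L[ℝ] ℝ) e)).mapL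
      (ContinuousLinearMap.apply ℝ ℝ e)
    simpa using this
  have h := hasSum_sum fun j (_ : j ∈ Finset.univ) => key j
  refine h.unique ?_
  simp only [fun p => sum_normRpowHessian_single (sub_ne_zero.2 (hx p))]
  exact hasSum_zero

end NormRpow

/-- Points `a m` growing at least linearly with `m ∈ ℤ^κ` give convergent series. -/
lemma summable_one_add_norm_rpow_of_lattice {κ F : Type*} [Fintype κ] [NormedAddCommGroup F]
    {s c C : ℝ} (hs : s < -(Fintype.card κ : ℝ)) (hc : 0 < c) {a : (κ → ℤ) → F}
    (h : ∀ m : κ → ℤ, c * ‖fun i => (m i : ℝ)‖ ≤ ‖a m‖ + C) :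
    Summable fun m => (1 + ‖a m‖) ^ s := by
  have hs0 : s < 0 := hs.trans_le (by simp)
  let b := Pi.basisFun ℝ κ
  let L := Submodule.span ℤ (Set.range b)
  have hL : Module.finrank ℤ L = Fintype.card κ := by
    rw [ZLattice.rank ℝ, Module.finrank_fintype_fun_eq_card]
  have hsum : Summable fun z : L => ‖z‖ ^ s := ZLattice.summable_norm_rpow L s (by rw [hL]; exact hs)
  let f : (κ → ℤ) → L := fun m => ⟨fun i => (m i : ℝ), by
    have : (fun i => (m i : ℝ)) = ∑ i, m i • b i := by
      classical
      ext j
      simp [b, Finset.sum_apply, Pi.basisFun_apply, Pi.single_apply]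
    rw [this]
    exact Submodule.sum_mem _ fun i _ =>
      Submodule.smul_mem _ _ (Submodule.subset_span (Set.mem_range_self i))⟩
  have hf : Function.Injective f := fun m m' hm => by
    ext i
    have h' : (m i : ℝ) = m' i := congrFun (congrArg Subtype.val hm) i
    exact_mod_cast h'
  have h1 := hsum.comp_injective hf
  let d := c / (1 + |C|)
  have hd : 0 < d := by positivity
  refine Summable.of_norm_bounded_eventually (h1.mul_left (d ^ s)) ?_
  refine (Set.finite_singleton (0 : κ → ℤ)).subset fun m hm => ?_
  by_contra hm0
  refine hm ?_
  have hpos : 0 < ‖f m‖ := norm_pos_iff.2 fun h0 => hm0 (hf (h0.trans (by ext i; simp [f])))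
  have hle : d * ‖f m‖ ≤ 1 + ‖a m‖ := by
    have : c * ‖f m‖ ≤ ‖a m‖ + C := h m
    rw [div_mul_eq_mul_div, div_le_iff₀ (by positivity)]
    nlinarith [le_abs_self C, norm_nonneg (a m), abs_nonneg C]
  rw [Set.mem_ofPred_eq, Real.norm_of_nonneg (by positivity), Function.comp_apply,
    ← Real.mul_rpow hd.le (norm_nonneg _)]
  exact Real.rpow_le_rpow_of_nonpos (by positivity) hle hs0.le

section KleinGroup

/-- Composition law of the parameters of the maps `kleinMap`. -/
def kleinMul {α : Type*} (p q : (α → ℤ) × ℤ) : (α → ℤ) × ℤ :=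
  (p.1 + q.1, p.2 + (p.2.negOnePow : ℤ) * q.2)

/-- Parameter of the inverse of `kleinMap`. -/
def kleinInv {α : Type*} (p : (α → ℤ) × ℤ) : (α → ℤ) × ℤ :=
  (-p.1, -((p.2.negOnePow : ℤ) * p.2))

lemma negOnePow_negOnePow_mul (a b : ℤ) : ((a.negOnePow : ℤ) * b).negOnePow = b.negOnePow := by
  rcases Int.even_or_odd a with h | h <;> simp [Int.negOnePow_even _, Int.negOnePow_odd _, h]

lemma kleinInv_involutive {α : Type*} : Function.Involutive (kleinInv (α := α)) := fun p => by
  simp only [kleinInv, Int.negOnePow_neg, negOnePow_negOnePow_mul, neg_neg, mul_neg, ← mul_assoc]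
  simp [← Units.val_mul]

lemma kleinMul_assoc {α : Type*} (p q r : (α → ℤ) × ℤ) :
    kleinMul (kleinMul p q) r = kleinMul p (kleinMul q r) := by
  simp only [kleinMul, Int.negOnePow_add, negOnePow_negOnePow_mul, Units.val_mul, add_assoc, mul_add,
    mul_assoc]

lemma kleinMul_kleinInv {α : Type*} (p : (α → ℤ) × ℤ) : kleinMul p (kleinInv p) = 0 := by
  simp only [kleinMul, kleinInv, mul_neg, ← mul_assoc]
  simp [← Units.val_mul]

lemma kleinMul_zero {α : Type*} (p : (α → ℤ) × ℤ) : kleinMul p 0 = p := by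
  simp [kleinMul]

lemma kleinInv_kleinMul {α : Type*} (p : (α → ℤ) × ℤ) : kleinMul (kleinInv p) p = 0 := by
  simpa only [kleinInv_involutive p] using kleinMul_kleinInv (kleinInv p)

/-- Right translation by `p` for the group law `kleinMul`. -/
def kleinMulRight {α : Type*} (p : (α → ℤ) × ℤ) : Equiv.Perm ((α → ℤ) × ℤ) where
  toFun q := kleinMul q p
  invFun q := kleinMul q (kleinInv p)
  left_inv q := by
    beta_reduce
    rw [kleinMul_assoc, kleinMul_kleinInv, kleinMul_zero]
  right_inv q := by
    beta_reduce
    rw [kleinMul_assoc, kleinInv_kleinMul, kleinMul_zero]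

variable {n d : ℕ} {w : Fin d → Euc n} {j : Fin n}

/-- The map `x ↦ x + μ + (((-1) ^ m - 1) x_j + m) e_j` with `μ = ∑ i, p.1 i • w i`, `m = p.2`. -/
def kleinMap (w : Fin d → Euc n) (j : Fin n) (p : (Fin d → ℤ) × ℤ) (x : Euc n) : Euc n :=
  x + (∑ i, (p.1 i : ℝ) • w i) +
    (((-1 : ℝ) ^ p.2 - 1) * x j + (p.2 : ℝ)) • EuclideanSpace.single j 1

lemma kleinMap_zero (x : Euc n) : kleinMap w j 0 x = x := by
  simp [kleinMap]

lemma kleinMap_apply_self (hw0 : ∀ i, w i j = 0) (p : (Fin d → ℤ) × ℤ) (x : Euc n) :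
    kleinMap w j p x j = (-1 : ℝ) ^ p.2 * x j + p.2 := by
  simp [kleinMap, hw0]
  ring

lemma kleinMap_kleinMap (hw0 : ∀ i, w i j = 0) (p q : (Fin d → ℤ) × ℤ) (x : Euc n) :
    kleinMap w j p (kleinMap w j q x) = kleinMap w j (kleinMul p q) x := by
  have h : (-1 : ℝ) ^ (kleinMul p q).2 = (-1) ^ p.2 * (-1) ^ q.2 := by
    rw [← Int.cast_negOnePow, ← Int.cast_negOnePow, ← Int.cast_negOnePow, kleinMul,
      Int.negOnePow_add, negOnePow_negOnePow_mul]
    push_cast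
    rfl
  have h' : ((kleinMul p q).2 : ℝ) = p.2 + (-1) ^ p.2 * q.2 := by
    rw [kleinMul, ← Int.cast_negOnePow]
    push_cast
    rfl
  have h'' : ∑ i, ((kleinMul p q).1 i : ℝ) • w i =
      ∑ i, (p.1 i : ℝ) • w i + ∑ i, (q.1 i : ℝ) • w i := by
    simp [kleinMul, add_smul, Finset.sum_add_distrib]
  conv_lhs => rw [kleinMap, kleinMap_apply_self hw0, kleinMap]
  rw [kleinMap, h, h', h'']
  module

lemma kleinMap_kleinInv_kleinMap (hw0 : ∀ i, w i j = 0) (p : (Fin d → ℤ) × ℤ) (x : Euc n) :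
    kleinMap w j (kleinInv p) (kleinMap w j p x) = x := by
  rw [kleinMap_kleinMap hw0, kleinInv_kleinMul, kleinMap_zero]

lemma kleinMap_kleinMap_kleinInv (hw0 : ∀ i, w i j = 0) (p : (Fin d → ℤ) × ℤ) (x : Euc n) :
    kleinMap w j p (kleinMap w j (kleinInv p) x) = x := by
  rw [kleinMap_kleinMap hw0, kleinMul_kleinInv, kleinMap_zero]

lemma norm_add_smul_single_sq (v : Euc n) (c : ℝ) :
    ‖v + (c * v j) • EuclideanSpace.single j (1 : ℝ)‖ ^ 2 = ‖v‖ ^ 2 + (c ^ 2 + 2 * c) * v j ^ 2 := by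
  rw [norm_add_sq_real, inner_smul_right, EuclideanSpace.inner_single_right, norm_smul]
  simp [mul_pow]
  ring

lemma isometry_kleinMap (w : Fin d → Euc n) (j : Fin n) (p : (Fin d → ℤ) × ℤ) :
    Isometry (kleinMap w j p) := by
  refine Isometry.of_dist_eq fun x y => ?_
  have h : kleinMap w j p x - kleinMap w j p y =
      (x - y) + (((-1 : ℝ) ^ p.2 - 1) * (x - y) j) • EuclideanSpace.single j (1 : ℝ) := by
    simp only [kleinMap, PiLp.sub_apply]
    module
  have hsq : ((-1 : ℝ) ^ p.2) ^ 2 = 1 := by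
    rw [← sq_abs, abs_neg_one_zpow, one_pow]
  rw [dist_eq_norm, dist_eq_norm, ← sq_eq_sq₀ (norm_nonneg _) (norm_nonneg _), h,
    norm_add_smul_single_sq]
  linear_combination ((x - y) j) ^ 2 * hsq

lemma exists_kleinMap_eq_linear_add (w : Fin d → Euc n) (j : Fin n) (p : (Fin d → ℤ) × ℤ) :
    ∃ (L : Euc n →ₗ[ℝ] Euc n) (b : Euc n), ∀ x, kleinMap w j p x = L x + b := by
  refine ⟨LinearMap.id + (((-1 : ℝ) ^ p.2 - 1) •
    (EuclideanSpace.proj j : Euc n →L[ℝ] ℝ).toLinearMap).smulRight (EuclideanSpace.single j 1),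
    (∑ i, (p.1 i : ℝ) • w i) + (p.2 : ℝ) • EuclideanSpace.single j 1,
    fun x => ?_⟩
  simp only [kleinMap, LinearMap.add_apply, LinearMap.id_apply, LinearMap.smulRight_apply,
    LinearMap.smul_apply, ContinuousLinearMap.coe_coe, PiLp.proj_apply, smul_eq_mul]
  module

lemma norm_kleinMap_sub (hw0 : ∀ i, w i j = 0) (p : (Fin d → ℤ) × ℤ) (x y : Euc n) :
    ‖kleinMap w j p x - y‖ = ‖x - kleinMap w j (kleinInv p) y‖ := by
  rw [← dist_eq_norm, ← dist_eq_norm, ← (isometry_kleinMap w j (kleinInv p)).dist_eq,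
    kleinMap_kleinInv_kleinMap hw0]

lemma tsum_norm_kleinMap_sub (hw0 : ∀ i, w i j = 0) (s : ℝ) (x y : Euc n) :
    ∑' p, ‖kleinMap w j p x - y‖ ^ s = ∑' p, ‖x - kleinMap w j p y‖ ^ s := by
  simp only [norm_kleinMap_sub hw0]
  exact (kleinInv_involutive.toPerm _).tsum_eq fun p => ‖x - kleinMap w j p y‖ ^ s

lemma forall_kleinMap_ne_iff (hw0 : ∀ i, w i j = 0) {x y : Euc n} :
    (∀ p, kleinMap w j p x ≠ y) ↔ ∀ p, x ≠ kleinMap w j p y := by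
  constructor <;> intro h p hp
  · exact h (kleinInv p) (by rw [hp, kleinMap_kleinInv_kleinMap hw0])
  · exact h (kleinInv p) (by rw [← hp, kleinMap_kleinInv_kleinMap hw0])

lemma exists_mul_norm_le_kleinMap (hw : LinearIndependent ℝ w) (hw0 : ∀ i, w i j = 0) :
    ∃ c > 0, ∀ (p : (Fin d → ℤ) × ℤ) (y : Euc n),
      c * ‖fun o : Option (Fin d) => ((o.elim p.2 p.1 : ℤ) : ℝ)‖ ≤
        ‖kleinMap w j p y‖ + (‖y‖ + 2 * |y j|) := by
  set e : Euc n := EuclideanSpace.single j 1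
  have he : e ∉ Submodule.span ℝ (Set.range w) := fun h => by
    have hle : Submodule.span ℝ (Set.range w) ≤
        (EuclideanSpace.proj j : Euc n →L[ℝ] ℝ).toLinearMap.ker := by
      rw [Submodule.span_le]
      rintro _ ⟨i, rfl⟩
      simpa using hw0 i
    have := hle h
    simp [e] at this
  have hli := linearIndependent_option'.2 ⟨hw, he⟩
  obtain ⟨K, hK, hf⟩ := LinearMap.exists_antilipschitzWith
    (Fintype.linearCombination ℝ fun o : Option (Fin d) => o.casesOn' e w)
    (LinearMap.ker_eq_bot.2 hli.fintypeLinearCombination_injective)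
  refine ⟨(K : ℝ)⁻¹, by positivity, fun p y => ?_⟩
  have h := hf.le_mul_dist (fun o : Option (Fin d) => ((o.elim p.2 p.1 : ℤ) : ℝ)) 0
  rw [map_zero, dist_zero_right, dist_zero_right] at h
  rw [inv_mul_le_iff₀ (by positivity)]
  refine h.trans ?_
  gcongr
  have heq : Fintype.linearCombination ℝ (fun o : Option (Fin d) => o.casesOn' e w)
      (fun o : Option (Fin d) => ((o.elim p.2 p.1 : ℤ) : ℝ)) =
      kleinMap w j p y - (y + (((-1 : ℝ) ^ p.2 - 1) * y j) • e) := by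
    simp only [Fintype.linearCombination_apply, Fintype.sum_option, Option.elim, Option.casesOn',
      kleinMap]
    module
  have h1 : |(-1 : ℝ) ^ p.2 - 1| ≤ 2 := by
    refine (abs_sub _ _).trans ?_
    rw [abs_neg_one_zpow]
    norm_num
  have he1 : ‖e‖ = 1 := by simp [e]
  rw [heq]
  refine (norm_sub_le _ _).trans (add_le_add_right ((norm_add_le _ _).trans ?_) _)
  rw [norm_smul, he1, mul_one, norm_mul, Real.norm_eq_abs, Real.norm_eq_abs]
  gcongr

lemma summable_one_add_norm_kleinMap (hw : LinearIndependent ℝ w) (hw0 : ∀ i, w i j = 0) {s : ℝ}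
    (hs : s < -((d : ℝ) + 1)) (y : Euc n) :
    Summable fun p => (1 + ‖kleinMap w j p y‖) ^ s := by
  obtain ⟨c, hc, h⟩ := exists_mul_norm_le_kleinMap hw hw0
  let e : (Option (Fin d) → ℤ) ≃ (Fin d → ℤ) × ℤ :=
    (Equiv.piOptionEquivProd (β := fun _ => ℤ)).trans (Equiv.prodComm _ _)
  rw [← e.summable_iff]
  refine summable_one_add_norm_rpow_of_lattice (κ := Option (Fin d)) (by simpa using hs) hc
    (a := fun m => kleinMap w j (e m) y) (C := ‖y‖ + 2 * |y j|) fun m => ?_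
  convert h (e m) y using 4 with o
  cases o <;> rfl

end KleinGroup

/-- Generalized Klein bottle: for `n ≥ 5`, `2 ≤ k ≤ n-3`, a rank-`(k-1)`
lattice `Ω = ℤw₁+⋯+ℤw_{k-1}` (the `w i` having vanishing coordinates `k,…,n`) and the maps
`γ_{(μ,m)}(x) = (x₁+μ₁,…,x_{k-1}+μ_{k-1}, (-1)^m x_k + m, x_{k+1},…,x_n)`, written as
`γ_{(μ,m)}(x) = x + μ + (((-1)^m - 1)·x_k + m) e_k`: (i) `{γ_{(μ,m)}}` is a group of affine
isometries of `ℝⁿ` under composition; (ii) the family `(|γ_{(μ,m)}(x)-y|^{2-n})` is summable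
whenever `γ_{(μ,m)}(x) ≠ y` for all `(μ,m)`, so `H*(x,y) = Σ |γ_{(μ,m)}(x)-y|^{2-n}` is well
defined; (iii) `H*(γ(x),y) = H*(x,y)` for every `γ` in the group; (iv) for fixed `y`,
`x ↦ H*(x,y)` is harmonic off the singular set. -/
theorem stmt14 (n k : ℕ) (hn : 5 ≤ n) (hk1 : 2 ≤ k) (hk2 : k ≤ n - 3)
    (w : Fin (k - 1) → Euc n) (hw : LinearIndependent ℝ w)
    (hw0 : ∀ (i : Fin (k - 1)) (j : Fin n), k - 1 ≤ (j : ℕ) → w i j = 0)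
    (γ : (Fin (k - 1) → ℤ) × ℤ → Euc n → Euc n)
    (hγ : ∀ (p : (Fin (k - 1) → ℤ) × ℤ) (x : Euc n),
      γ p x = x + (∑ i, (p.1 i : ℝ) • w i) +
        (((-1 : ℝ) ^ p.2 - 1) * x ⟨k - 1, by omega⟩ + (p.2 : ℝ)) •
          EuclideanSpace.single ⟨k - 1, by omega⟩ 1)
    (H : Euc n → Euc n → ℝ)
    (hH : ∀ x y : Euc n,
      H x y = ∑' p : (Fin (k - 1) → ℤ) × ℤ, ‖γ p x - y‖ ^ (2 - (n : ℝ))) :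
    -- (i) a group of affine isometries under composition
    ((∀ p, Isometry (γ p)) ∧
     (∀ p, ∃ (L : Euc n →ₗ[ℝ] Euc n) (b : Euc n), ∀ x, γ p x = L x + b) ∧
     (∃ p, γ p = id) ∧
     (∀ p q, ∃ r, γ p ∘ γ q = γ r) ∧
     (∀ p, ∃ q, γ p ∘ γ q = id ∧ γ q ∘ γ p = id)) ∧
    -- (ii) summability
    (∀ x y : Euc n, (∀ p, γ p x ≠ y) →
      Summable (fun p : (Fin (k - 1) → ℤ) × ℤ => ‖γ p x - y‖ ^ (2 - (n : ℝ)))) ∧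
    -- (iii) invariance
    (∀ x y : Euc n, (∀ p, γ p x ≠ y) → ∀ p, H (γ p x) y = H x y) ∧
    -- (iv) harmonicity in x for fixed y
    (∀ y : Euc n,
      ContDiffOn ℝ 2 (fun x => H x y) {x | ∀ p, γ p x ≠ y} ∧
      ∀ x : Euc n, (∀ p, γ p x ≠ y) →
        ∑ j : Fin n,
          fderiv ℝ (fun z => fderiv ℝ (fun x' => H x' y) z (EuclideanSpace.single j 1)) x
            (EuclideanSpace.single j 1) = 0) := by
  set j : Fin n := ⟨k - 1, by omega⟩ with hj
  have hwj : ∀ i, w i j = 0 := fun i => hw0 i j le_rfl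
  obtain rfl : γ = kleinMap w j := by
    funext p x
    exact hγ p x
  have hs : 2 - (n : ℝ) < -(((k - 1 : ℕ) : ℝ) + 1) := by
    have : k - 1 + 1 + 2 < n := by omega
    have : (((k - 1 : ℕ) : ℝ) + 1 + 2) < n := by exact_mod_cast this
    linarith
  have hs0 : 2 - (n : ℝ) < 0 := hs.trans (by linarith [(k - 1).cast_nonneg (α := ℝ)])
  have hsum := summable_one_add_norm_kleinMap hw hwj hs
  have hH' : ∀ x y, H x y = ∑' p, ‖x - kleinMap w j p y‖ ^ (2 - (n : ℝ)) := fun x y => by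
    rw [hH, tsum_norm_kleinMap_sub hwj]
  refine ⟨⟨isometry_kleinMap w j, exists_kleinMap_eq_linear_add w j,
    ⟨0, funext kleinMap_zero⟩, fun p q => ⟨kleinMul p q, funext (kleinMap_kleinMap hwj p q)⟩,
    fun p => ⟨kleinInv p, funext (kleinMap_kleinMap_kleinInv hwj p),
      funext (kleinMap_kleinInv_kleinMap hwj p)⟩⟩, fun x y hxy => ?_, fun x y _ p => ?_,
    fun y => ⟨?_, fun x hx => ?_⟩⟩
  · simpa only [norm_sub_rev y] using summable_norm_sub_rpow hs0 (hsum x) fun p => (hxy p).symm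
  · simp only [hH, kleinMap_kleinMap hwj]
    exact (kleinMulRight p).tsum_eq fun q => ‖kleinMap w j q x - y‖ ^ (2 - (n : ℝ))
  · simp only [hH', forall_kleinMap_ne_iff hwj]
    exact contDiffOn_tsum_norm_sub_rpow hs0 (hsum y)
  · simp only [hH']
    exact sum_fderiv_fderiv_tsum_norm_sub_rpow (by omega) (hsum y)
      ((forall_kleinMap_ne_iff hwj).1 hx)
end
end
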